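/- Let A ⊆ ℝ^d be nonempty, n ∈ ℕ_0, and for each m ∈ ℕ let f_m be real-analytic on a neighbourhood of A with a bounded holomorphic extension to the complex r_m-neighbourhood D_{r_m}(A) of A, with r_m ↓ 0. If Σ_{m=1}^∞ ‖f_m‖_{r_m,A} · r_m^{-n} < ∞, then f := Σ_m f_m is C^n on A in the sense of Whitney, with Whitney derivatives f_ν = Σ_m ∂_y^ν f_m for |ν|_1 ≤ n. -/

import Mathlib

/-- Partial derivative of a function on `ℂ^d` in the `j`-th coordinate direction. -/
noncomputable def cPartial (d : ℕ) (j : Fin d) (g : (Fin d → ℂ) → ℂ) : (Fin d → ℂ) → ℂ :=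
  fun z => fderiv ℂ g z (Pi.single j 1)

/-- The multi-index partial derivative `∂^ν g` for `ν : Fin d → ℕ`. -/
noncomputable def cMultiPartial (d : ℕ) (ν : Fin d → ℕ) (g : (Fin d → ℂ) → ℂ) :
    (Fin d → ℂ) → ℂ :=
  (List.finRange d).foldr (fun j h => (cPartial d j)^[ν j] h) g

/-- `F : (multi-index) → A → ℝ` is a family of Whitney derivatives exhibiting `F 0` as a
`C^n` function on `A` in the sense of Whitney. -/
def IsWhitneyCn (d n : ℕ) (A : Set (Fin d → ℝ)) (F : (Fin d → ℕ) → (Fin d → ℝ) → ℝ) : Prop :=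
  ∀ ε : ℝ, 0 < ε → ∀ y₀ ∈ A, ∃ δ : ℝ, 0 < δ ∧
    ∀ y ∈ A ∩ Metric.ball y₀ δ, ∀ y' ∈ A ∩ Metric.ball y₀ δ,
      ∀ ν : Fin d → ℕ, (∑ j, ν j) ≤ n →
        |F ν y' - ∑ μ ∈ (Finset.Iic (fun _ => n : Fin d → ℕ)).filter
            (fun μ => (∑ j, μ j) ≤ n - (∑ j, ν j)),
            (F (ν + μ) y * ∏ j, (y' j - y j) ^ (μ j)) / ∏ j, (Nat.factorial (μ j) : ℝ)|
          ≤ ε * ‖y' - y‖ ^ (n - ∑ j, ν j)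

open Metric Set Filter Topology

section Holomorphic

variable {E : Type*} [NormedAddCommGroup E] [NormedSpace ℂ E]

theorem hasDerivAt_comp_line {g : E → ℂ} {w u : E} {t : ℂ}
    (hg : DifferentiableAt ℂ g (w + t • u)) :
    HasDerivAt (fun s : ℂ => g (w + s • u)) (fderiv ℂ g (w + t • u) u) t := by
  have h1 : HasDerivAt (fun s : ℂ => w + s • u) u t := by
    simpa using ((hasDerivAt_id t).smul_const u).const_add w
  exact hg.hasFDerivAt.comp_hasDerivAt t h1

/-- Cauchy's estimate for directional derivatives. -/
theorem norm_fderiv_apply_le_of_forall_mem_ball {g : E → ℂ} {w u : E} {s M : ℝ} (hs : 0 < s)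
    (hu : ‖u‖ ≤ 1) (hg : DifferentiableOn ℂ g (ball w s)) (hM : ∀ z ∈ ball w s, ‖g z‖ ≤ M) :
    ‖fderiv ℂ g w u‖ ≤ M / s := by
  have hmem : ∀ t : ℂ, ‖t‖ < s → w + t • u ∈ ball w s := by
    intro t ht
    rw [mem_ball, dist_eq_norm, add_sub_cancel_left, norm_smul]
    nlinarith [norm_nonneg t, norm_nonneg u]
  have hd : ∀ t : ℂ, ‖t‖ < s →
      HasDerivAt (fun t : ℂ => g (w + t • u)) (fderiv ℂ g (w + t • u) u) t := fun t ht =>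
    hasDerivAt_comp_line (hg.differentiableAt (isOpen_ball.mem_nhds (hmem t ht)))
  have key : ∀ s' ∈ Ioo 0 s, ‖fderiv ℂ g w u‖ ≤ M / s' := by
    intro s' hs'
    have h0 := (hd 0 (by simpa using hs)).deriv
    simp only [zero_smul, add_zero] at h0
    rw [← h0]
    have hlt : ∀ t ∈ closedBall (0 : ℂ) s', ‖t‖ < s := fun t ht =>
      (mem_closedBall_zero_iff.1 ht).trans_lt hs'.2
    refine Complex.norm_deriv_le_of_forall_mem_sphere_norm_le hs'.1 ?_ ?_
    · refine DifferentiableOn.diffContOnCl fun t ht => ?_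
      exact (hd t (hlt t (closure_ball_subset_closedBall ht))).differentiableAt
        |>.differentiableWithinAt
    · intro t ht
      exact hM _ (hmem t (hlt t (sphere_subset_closedBall ht)))
  have hlim : Tendsto (fun s' => M / s') (𝓝[<] s) (𝓝 (M / s)) :=
    (tendsto_const_nhds.div tendsto_id hs.ne').mono_left nhdsWithin_le_nhds
  refine ge_of_tendsto hlim ?_
  filter_upwards [Ioo_mem_nhdsLT hs] with s' hs' using key s' hs'

/-- Directional derivatives of holomorphic functions of several variables are holomorphic. -/
theorem differentiableOn_fderiv_apply [FiniteDimensional ℂ E] {g : E → ℂ} {U : Set E}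
    (hU : IsOpen U) (hg : DifferentiableOn ℂ g U) {v : E} (hv : ‖v‖ ≤ 1) :
    DifferentiableOn ℂ (fun z => fderiv ℂ g z v) U := by
  intro z₀ hz₀
  apply DifferentiableAt.differentiableWithinAt
  obtain ⟨R, hR, hRU, M, hM⟩ : ∃ R > 0, ball z₀ R ⊆ U ∧ ∃ M, ∀ z ∈ ball z₀ R, ‖g z‖ ≤ M := by
    have hc : ContinuousAt g z₀ := (hg.differentiableAt (hU.mem_nhds hz₀)).continuousAt
    have h1 : ∀ᶠ z in 𝓝 z₀, ‖g z‖ ≤ ‖g z₀‖ + 1 :=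
      (hc.norm.eventually_lt continuousAt_const (lt_add_one _)).mono fun _ h => h.le
    obtain ⟨R, hR, h⟩ := Metric.mem_nhds_iff.1 (Filter.inter_mem (hU.mem_nhds hz₀) h1)
    exact ⟨R, hR, fun z hz => (h hz).1, _, fun z hz => (h hz).2⟩
  have hgR := hg.mono hRU
  obtain ⟨ρ, hρ, hρR⟩ : ∃ ρ > 0, 4 * ρ = R := ⟨R / 4, by positivity, by ring⟩
  have hmem : ∀ z ∈ ball z₀ ρ, ∀ t : ℂ, ‖t‖ ≤ ρ → ball (z + t • v) ρ ⊆ ball z₀ R := by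
    intro z hz t ht y hy
    rw [mem_ball] at hz hy ⊢
    have h1 : dist (z + t • v) z ≤ ρ := by
      rw [dist_eq_norm, add_sub_cancel_left, norm_smul]
      nlinarith [norm_nonneg t, norm_nonneg v]
    linarith [dist_triangle y (z + t • v) z₀, dist_triangle (z + t • v) z z₀]
  have hcirc : ∀ θ, ‖circleMap 0 ρ θ‖ ≤ ρ := fun θ => by simp [abs_of_pos hρ]
  have hdiff : ∀ z ∈ ball z₀ ρ, ∀ t : ℂ, ‖t‖ ≤ ρ → DifferentiableAt ℂ g (z + t • v) :=
    fun z hz t ht => hgR.differentiableAt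
      (isOpen_ball.mem_nhds (hmem z hz t ht (mem_ball_self hρ)))
  let c : ℝ → ℂ := fun θ => deriv (circleMap 0 ρ) θ * (circleMap 0 ρ θ ^ 2)⁻¹
  have hcc : Continuous c := by
    have h1 : Continuous fun θ => circleMap 0 ρ θ := continuous_circleMap 0 ρ
    simp only [c, deriv_circleMap]
    exact (h1.mul continuous_const).mul ((h1.pow 2).inv₀ fun θ =>
      pow_ne_zero 2 (circleMap_ne_center hρ.ne'))
  have hformula : ∀ z ∈ ball z₀ ρ, fderiv ℂ g z v =
      (2 * Real.pi * Complex.I : ℂ)⁻¹ *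
        ∫ θ in (0 : ℝ)..2 * Real.pi, c θ * g (z + circleMap 0 ρ θ • v) := by
    intro z hz
    let V : Set ℂ := {t | z + t • v ∈ ball z₀ R}
    have hV : IsOpen V := isOpen_ball.preimage (by fun_prop)
    have h := Complex.two_pi_I_inv_smul_circleIntegral_sub_sq_inv_smul_of_differentiable hV
      (c := 0) (w₀ := 0) (R := ρ) (f := fun t : ℂ => g (z + t • v))
      (fun t ht => hmem z hz t (mem_closedBall_zero_iff.1 ht) (mem_ball_self hρ))
      (fun t ht => (hasDerivAt_comp_line (hgR.differentiableAt
        (isOpen_ball.mem_nhds ht))).differentiableAt.differentiableWithinAt)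
      (mem_ball_self hρ)
    have h0 : DifferentiableAt ℂ g (z + (0 : ℂ) • v) := hdiff z hz 0 (by simpa using hρ.le)
    rw [(hasDerivAt_comp_line h0).deriv] at h
    simp only [zero_smul, add_zero] at h
    rw [← h, circleIntegral, smul_eq_mul]
    simp only [c, smul_eq_mul, sub_zero, mul_assoc]
  have hnhds : ball z₀ ρ ∈ 𝓝 z₀ := ball_mem_nhds z₀ hρ
  suffices H : DifferentiableAt ℂ
      (fun z => ∫ θ in (0 : ℝ)..2 * Real.pi, c θ * g (z + circleMap 0 ρ θ • v)) z₀ from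
    (H.const_mul _).congr_of_eventuallyEq (by filter_upwards [hnhds] with z hz using hformula z hz)
  have hcont : ∀ z ∈ ball z₀ ρ, Continuous fun θ => c θ * g (z + circleMap 0 ρ θ • v) := by
    intro z hz
    refine hcc.mul (continuous_iff_continuousAt.2 fun θ => ?_)
    have h1 : ContinuousAt (fun θ => z + circleMap 0 ρ θ • v) θ :=
      (continuous_const.add ((continuous_circleMap 0 ρ).smul continuous_const)).continuousAt
    exact ContinuousAt.comp (g := g) (hdiff z hz _ (hcirc θ)).continuousAt h1
  let _ : MeasurableSpace E := borel E
  have : BorelSpace E := ⟨rfl⟩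
  have : ProperSpace E := FiniteDimensional.proper ℂ E
  have := intervalIntegral.hasFDerivAt_integral_of_dominated_of_fderiv_le (𝕜 := ℂ)
    (μ := MeasureTheory.volume) (a := 0) (b := 2 * Real.pi)
    (F := fun z θ => c θ * g (z + circleMap 0 ρ θ • v))
    (F' := fun z θ => c θ • fderiv ℂ g (z + circleMap 0 ρ θ • v))
    (bound := fun θ => ‖c θ‖ * (M / ρ)) hnhds
    (by filter_upwards [hnhds] with z hz using (hcont z hz).aestronglyMeasurable)
    ((hcont z₀ (mem_ball_self hρ)).intervalIntegrable _ _)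
    (by
      refine hcc.aestronglyMeasurable.smul ?_
      have h1 : Continuous fun θ => z₀ + circleMap 0 ρ θ • v :=
        continuous_const.add ((continuous_circleMap 0 ρ).smul continuous_const)
      have : SecondCountableTopology (E →L[ℂ] ℂ) :=
        have : ProperSpace (E →L[ℂ] ℂ) := FiniteDimensional.proper ℂ _
        inferInstance
      exact (measurable_fderiv ℂ g).stronglyMeasurable.comp_measurable h1.measurable
        |>.aestronglyMeasurable)
    (Eventually.of_forall fun θ _ z hz => by
      rw [norm_smul]
      gcongr
      have hsub := hmem z hz _ (hcirc θ)
      have hM0 : 0 ≤ M := (norm_nonneg _).trans (hM _ (mem_ball_self hR))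
      refine ContinuousLinearMap.opNorm_le_of_unit_norm (𝕜 := ℂ) (by positivity) fun u hu => ?_
      exact norm_fderiv_apply_le_of_forall_mem_ball hρ hu.le (hgR.mono hsub)
        fun y hy => hM y (hsub hy))
    ((hcc.norm.mul continuous_const).intervalIntegrable _ _)
    (Eventually.of_forall fun θ _ z hz => by
      have h1 : HasFDerivAt (fun z : E => z + circleMap 0 ρ θ • v) (ContinuousLinearMap.id ℂ E) z :=
        (hasFDerivAt_id z).add_const _
      exact ((hdiff z hz _ (hcirc θ)).hasFDerivAt.comp z h1).const_mul (c θ))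
  exact this.differentiableAt

end Holomorphic

variable {d : ℕ}

theorem differentiableOn_cPartial {g : (Fin d → ℂ) → ℂ} {U : Set (Fin d → ℂ)} (hU : IsOpen U)
    (hg : DifferentiableOn ℂ g U) (j : Fin d) : DifferentiableOn ℂ (cPartial d j g) U := by
  refine differentiableOn_fderiv_apply hU hg (v := Pi.single j 1) ?_
  simp [Pi.norm_single]

theorem norm_cPartial_le {g : (Fin d → ℂ) → ℂ} {w : Fin d → ℂ} {s M : ℝ} (hs : 0 < s)
    (hg : DifferentiableOn ℂ g (ball w s)) (hM : ∀ z ∈ ball w s, ‖g z‖ ≤ M) (j : Fin d) :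
    ‖cPartial d j g w‖ ≤ M / s := by
  refine norm_fderiv_apply_le_of_forall_mem_ball hs ?_ hg hM
  simp [Pi.norm_single]

theorem fderiv_apply_eq_sum_cPartial (g : (Fin d → ℂ) → ℂ) (z u : Fin d → ℂ) :
    fderiv ℂ g z u = ∑ j, u j * cPartial d j g z := by
  conv_lhs => rw [pi_eq_sum_univ' u]
  simp only [map_sum, map_smul, smul_eq_mul, cPartial]

theorem cPartial_comm {g : (Fin d → ℂ) → ℂ} {U : Set (Fin d → ℂ)} (hU : IsOpen U)
    (hg : DifferentiableOn ℂ g U) (i j : Fin d) {z : Fin d → ℂ} (hz : z ∈ U) :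
    cPartial d i (cPartial d j g) z = cPartial d j (cPartial d i g) z := by
  have hd : DifferentiableAt ℂ (fderiv ℂ g) z := by
    have h : fderiv ℂ g = fun y => ∑ k, cPartial d k g y •
        (ContinuousLinearMap.proj k : (Fin d → ℂ) →L[ℂ] ℂ) := by
      ext1 y
      ext1 u
      simp [fderiv_apply_eq_sum_cPartial, mul_comm]
    rw [h]
    exact DifferentiableAt.fun_sum fun k _ =>
      ((differentiableOn_cPartial hU hg k).differentiableAt (hU.mem_nhds hz)).smul_const _
  have hsymm := second_derivative_symmetric_of_eventually (𝕜 := ℂ) (f := g) (x := z)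
    (by filter_upwards [hU.mem_nhds hz] with y hy using
      (hg.differentiableAt (hU.mem_nhds hy)).hasFDerivAt) hd.hasFDerivAt
  have h : ∀ k l : Fin d, cPartial d k (cPartial d l g) z =
      fderiv ℂ (fderiv ℂ g) z (Pi.single k 1) (Pi.single l 1) := by
    intro k l
    change fderiv ℂ (fun y => fderiv ℂ g y (Pi.single l 1)) z (Pi.single k 1) = _
    rw [fderiv_clm_apply hd (by fun_prop)]
    simp
  rw [h, h, hsymm]

theorem cPartial_congr {g g' : (Fin d → ℂ) → ℂ} {U : Set (Fin d → ℂ)} (hU : IsOpen U)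
    (h : EqOn g g' U) (j : Fin d) : EqOn (cPartial d j g) (cPartial d j g') U := fun z hz => by
  have : g =ᶠ[𝓝 z] g' := by filter_upwards [hU.mem_nhds hz] with y hy using h hy
  simp only [cPartial, this.fderiv_eq]

theorem iterate_cPartial_congr {g g' : (Fin d → ℂ) → ℂ} {U : Set (Fin d → ℂ)} (hU : IsOpen U)
    (h : EqOn g g' U) (j : Fin d) (k : ℕ) :
    EqOn ((cPartial d j)^[k] g) ((cPartial d j)^[k] g') U := by
  induction k generalizing g g' with
  | zero => exact h
  | succ k ih => exact ih (cPartial_congr hU h j)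

theorem differentiableOn_iterate_cPartial {g : (Fin d → ℂ) → ℂ} {U : Set (Fin d → ℂ)}
    (hU : IsOpen U) (hg : DifferentiableOn ℂ g U) (j : Fin d) (k : ℕ) :
    DifferentiableOn ℂ ((cPartial d j)^[k] g) U := by
  induction k generalizing g with
  | zero => exact hg
  | succ k ih => exact ih (differentiableOn_cPartial hU hg j)

theorem iterate_cPartial_comm {g : (Fin d → ℂ) → ℂ} {U : Set (Fin d → ℂ)} (hU : IsOpen U)
    (hg : DifferentiableOn ℂ g U) (i j : Fin d) (k : ℕ) :
    EqOn ((cPartial d i)^[k] (cPartial d j g)) (cPartial d j ((cPartial d i)^[k] g)) U := by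
  induction k generalizing g with
  | zero => exact fun _ _ => rfl
  | succ k ih =>
    refine EqOn.trans ?_ (ih (differentiableOn_cPartial hU hg i))
    exact iterate_cPartial_congr hU (fun z hz => cPartial_comm hU hg i j hz) i k

theorem differentiableOn_foldr_cPartial {g : (Fin d → ℂ) → ℂ} {U : Set (Fin d → ℂ)}
    (hU : IsOpen U) (hg : DifferentiableOn ℂ g U) (ν : Fin d → ℕ) (l : List (Fin d)) :
    DifferentiableOn ℂ (l.foldr (fun j h => (cPartial d j)^[ν j] h) g) U := by
  induction l with
  | nil => exact hg
  | cons i l ih => exact differentiableOn_iterate_cPartial hU ih i _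

theorem foldr_cPartial_add_single {g : (Fin d → ℂ) → ℂ} {U : Set (Fin d → ℂ)}
    (hU : IsOpen U) (hg : DifferentiableOn ℂ g U) (ν : Fin d → ℕ) (j : Fin d)
    (l : List (Fin d)) (hl : l.Nodup) :
    EqOn (l.foldr (fun i h => (cPartial d i)^[(ν + Pi.single j 1 : Fin d → ℕ) i] h) g)
      (if j ∈ l then cPartial d j (l.foldr (fun i h => (cPartial d i)^[ν i] h) g)
        else l.foldr (fun i h => (cPartial d i)^[ν i] h) g) U := by
  induction l with
  | nil => exact fun _ _ => rfl
  | cons i l ih =>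
    obtain ⟨hil, hl⟩ := List.nodup_cons.1 hl
    have hcongr := iterate_cPartial_congr hU (ih hl) i ((ν + Pi.single j 1 : Fin d → ℕ) i)
    have hd := differentiableOn_foldr_cPartial hU hg ν l
    rw [List.foldr_cons, List.foldr_cons]
    refine hcongr.trans ?_
    by_cases hij : j = i
    · subst hij
      simp only [hil, if_false, List.mem_cons, true_or, if_true, Pi.add_apply, Pi.single_eq_same]
      rw [Function.iterate_succ_apply']
      exact fun _ _ => rfl
    · have h0 : (ν + Pi.single j 1 : Fin d → ℕ) i = ν i := by simp [Ne.symm hij]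
      rw [h0]
      by_cases hjl : j ∈ l
      · simp only [hjl, List.mem_cons, or_true, if_true]
        exact iterate_cPartial_comm hU hd i j _
      · simp only [hjl, hij, List.mem_cons, or_false, if_false]
        exact fun _ _ => rfl

theorem differentiableOn_cMultiPartial {g : (Fin d → ℂ) → ℂ} {U : Set (Fin d → ℂ)}
    (hU : IsOpen U) (hg : DifferentiableOn ℂ g U) (ν : Fin d → ℕ) :
    DifferentiableOn ℂ (cMultiPartial d ν g) U :=
  differentiableOn_foldr_cPartial hU hg ν _

theorem cPartial_cMultiPartial {g : (Fin d → ℂ) → ℂ} {U : Set (Fin d → ℂ)}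
    (hU : IsOpen U) (hg : DifferentiableOn ℂ g U) (ν : Fin d → ℕ) (j : Fin d)
    {z : Fin d → ℂ} (hz : z ∈ U) :
    cPartial d j (cMultiPartial d ν g) z = cMultiPartial d (ν + Pi.single j 1) g z := by
  have h := foldr_cPartial_add_single hU hg ν j (List.finRange d) (List.nodup_finRange d) hz
  rw [if_pos (List.mem_finRange j)] at h
  exact h.symm

theorem cMultiPartial_zero (g : (Fin d → ℂ) → ℂ) : cMultiPartial d 0 g = g := by
  unfold cMultiPartial
  induction List.finRange d with
  | nil => rfl
  | cons i l ih => simp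

theorem sum_add_single (ν : Fin d → ℕ) (j : Fin d) :
    ∑ i, (ν + Pi.single j 1 : Fin d → ℕ) i = ∑ i, ν i + 1 := by
  simp [Finset.sum_add_distrib]

theorem exists_eq_add_single {ν : Fin d → ℕ} {k : ℕ} (hν : ∑ i, ν i = k + 1) :
    ∃ ν' : Fin d → ℕ, ∃ j, ν = ν' + Pi.single j 1 ∧ ∑ i, ν' i = k := by
  obtain ⟨j, -, hj⟩ : ∃ j ∈ Finset.univ, ν j ≠ 0 :=
    Finset.exists_ne_zero_of_sum_ne_zero (by omega)
  have h : ν = (ν - Pi.single j 1) + Pi.single j 1 := by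
    refine (tsub_add_cancel_of_le fun i => ?_).symm
    by_cases hij : i = j
    · subst hij
      simpa using Nat.one_le_iff_ne_zero.2 hj
    · simp [hij]
  refine ⟨_, j, h, ?_⟩
  rw [h, sum_add_single] at hν
  omega

/-- Iterated Cauchy estimates on shrinking balls. -/
theorem norm_cMultiPartial_le_of_sum_eq {g : (Fin d → ℂ) → ℂ} {z : Fin d → ℂ} {R s M : ℝ}
    (hs : 0 < s) (hg : DifferentiableOn ℂ g (ball z R)) (hM : ∀ w ∈ ball z R, ‖g w‖ ≤ M) (k : ℕ)
    {ν : Fin d → ℕ} (hν : ∑ i, ν i = k) {w : Fin d → ℂ} (hw : w ∈ ball z (R - k * s)) :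
    ‖cMultiPartial d ν g w‖ ≤ M / s ^ k := by
  induction k generalizing ν w with
  | zero =>
    obtain rfl : ν = 0 := funext fun i => by simpa using (Finset.sum_eq_zero_iff.1 hν) i
    rw [cMultiPartial_zero]
    simpa using hM w (by simpa using hw)
  | succ k ih =>
    obtain ⟨ν', j, rfl, hν'⟩ := exists_eq_add_single hν
    have hsub : ball w s ⊆ ball z (R - k * s) := by
      intro y hy
      rw [mem_ball] at hy hw ⊢
      push_cast at hw
      linarith [dist_triangle y w z]
    have hsub' : ball z (R - k * s) ⊆ ball z R := ball_subset_ball (by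
      have : 0 ≤ k * s := by positivity
      linarith)
    have hwR : w ∈ ball z R := hsub' (hsub (mem_ball_self hs))
    rw [← cPartial_cMultiPartial isOpen_ball hg ν' j hwR, pow_succ, ← div_div]
    exact norm_cPartial_le hs ((differentiableOn_cMultiPartial isOpen_ball hg ν').mono
      (hsub.trans hsub')) (fun y hy => ih hν' (hsub hy)) j

theorem norm_cMultiPartial_le {g : (Fin d → ℂ) → ℂ} {z : Fin d → ℂ} {R M : ℝ}
    (hR : 0 < R) (hg : DifferentiableOn ℂ g (ball z R)) (hM : ∀ w ∈ ball z R, ‖g w‖ ≤ M) {N : ℕ}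
    (hN : 0 < N) {ν : Fin d → ℕ} (hν : ∑ i, ν i ≤ N) {w : Fin d → ℂ} (hw : w ∈ ball z (R / 2)) :
    ‖cMultiPartial d ν g w‖ ≤ (2 * N) ^ N * M / R ^ (∑ i, ν i) := by
  have hN' : (1 : ℝ) ≤ N := by exact_mod_cast hN
  have hM0 : 0 ≤ M := (norm_nonneg _).trans (hM z (mem_ball_self hR))
  have hs : 0 < R / (2 * N) := by positivity
  have h := norm_cMultiPartial_le_of_sum_eq hs hg hM _ rfl (w := w) (ν := ν) (ball_subset_ball (by
    have : (∑ i, ν i : ℕ) * (R / (2 * N)) ≤ N * (R / (2 * N)) := by gcongr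
    have h2 : N * (R / (2 * N)) = R / 2 := by field_simp
    linarith) hw)
  refine h.trans ?_
  rw [div_pow, div_div_eq_mul_div, mul_comm]
  gcongr
  linarith

/-- Multi-indices of total degree less than `p`. -/
def multiIndexLT (d p : ℕ) : Finset (Fin d → ℕ) :=
  (Finset.Iic fun _ => p).filter fun μ => ∑ j, μ j < p

theorem mem_multiIndexLT {p : ℕ} {μ : Fin d → ℕ} : μ ∈ multiIndexLT d p ↔ ∑ j, μ j < p := by
  simp only [multiIndexLT, Finset.mem_filter, Finset.mem_Iic, and_iff_right_iff_imp]
  exact fun h i => (Finset.single_le_sum (fun _ _ => Nat.zero_le _) (Finset.mem_univ i)).trans h.le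

/-- The normalized monomial `h ^ μ / μ!`. -/
noncomputable def monomialDivFactorial (μ : Fin d → ℕ) (h : Fin d → ℂ) : ℂ :=
  ∏ j, h j ^ μ j / (Nat.factorial (μ j) : ℂ)

theorem monomialDivFactorial_smul (μ : Fin d → ℕ) (t : ℂ) (h : Fin d → ℂ) :
    monomialDivFactorial μ (t • h) = t ^ (∑ j, μ j) * monomialDivFactorial μ h := by
  simp only [monomialDivFactorial, Pi.smul_apply, smul_eq_mul, mul_pow, mul_div_assoc,
    Finset.prod_mul_distrib, Finset.prod_pow_eq_pow_sum]

theorem monomialDivFactorial_add_single (μ : Fin d → ℕ) (j : Fin d) (h : Fin d → ℂ) :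
    (μ j + 1 : ℂ) * monomialDivFactorial (μ + Pi.single j 1) h =
      h j * monomialDivFactorial μ h := by
  simp only [monomialDivFactorial]
  rw [← Finset.mul_prod_erase _ _ (Finset.mem_univ j),
    ← Finset.mul_prod_erase Finset.univ (fun i => h i ^ μ i / _) (Finset.mem_univ j)]
  have : ∏ i ∈ Finset.univ.erase j, h i ^ (μ + Pi.single j 1 : Fin d → ℕ) i /
      (Nat.factorial ((μ + Pi.single j 1 : Fin d → ℕ) i) : ℂ) =
      ∏ i ∈ Finset.univ.erase j, h i ^ μ i / (Nat.factorial (μ i) : ℂ) :=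
    Finset.prod_congr rfl fun i hi => by simp [(Finset.mem_erase.1 hi).1]
  rw [this, ← mul_assoc, ← mul_assoc]
  congr 1
  have h1 : (μ j + 1 : ℂ) ≠ 0 := Nat.cast_add_one_ne_zero _
  have h2 : (Nat.factorial (μ j) : ℂ) ≠ 0 := Nat.cast_ne_zero.2 (Nat.factorial_ne_zero _)
  simp only [Pi.add_apply, Pi.single_eq_same, Nat.factorial_succ, pow_succ]
  push_cast
  field_simp

theorem norm_monomialDivFactorial_le (μ : Fin d → ℕ) (h : Fin d → ℂ) :
    ‖monomialDivFactorial μ h‖ ≤ ‖h‖ ^ (∑ j, μ j) := by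
  rw [monomialDivFactorial, norm_prod, ← Finset.prod_pow_eq_pow_sum]
  refine Finset.prod_le_prod (fun _ _ => norm_nonneg _) fun j _ => ?_
  rw [norm_div, norm_pow, Complex.norm_natCast]
  refine (div_le_self (by positivity) (by exact_mod_cast Nat.factorial_pos _)).trans ?_
  gcongr
  exact norm_le_pi_norm h j

/-- The polynomial `∑ a_μ h^μ / μ!` over multi-indices of total degree less than `p`. -/
noncomputable def taylorPoly (a : (Fin d → ℕ) → ℂ) (p : ℕ) (h : Fin d → ℂ) : ℂ :=
  ∑ μ ∈ multiIndexLT d p, a μ * monomialDivFactorial μ h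

theorem sum_multiIndexLT_succ (f : (Fin d → ℕ) → ℂ) (p : ℕ) (j : Fin d) :
    ∑ μ ∈ multiIndexLT d (p + 1), (μ j : ℂ) * f μ =
      ∑ μ ∈ multiIndexLT d p, (μ j + 1 : ℂ) * f (μ + Pi.single j 1) := by
  symm
  refine Finset.sum_of_injOn (fun μ => μ + Pi.single j 1) (fun _ _ _ _ h => add_right_cancel h)
    (fun μ hμ => ?_) (fun μ hμ hμ' => ?_) (fun μ _ => by simp)
  · rw [SetLike.mem_coe, mem_multiIndexLT] at hμ ⊢
    rw [sum_add_single]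
    omega
  · by_cases h0 : μ j = 0
    · simp [h0]
    · refine absurd ⟨μ - Pi.single j 1, ?_, ?_⟩ hμ'
      all_goals
        have h : (μ - Pi.single j 1) + Pi.single j 1 = μ := by
          refine tsub_add_cancel_of_le fun i => ?_
          by_cases hij : i = j
          · subst hij
            simpa using Nat.one_le_iff_ne_zero.2 h0
          · simp [hij]
      · rw [SetLike.mem_coe, mem_multiIndexLT]
        rw [mem_multiIndexLT, ← h, sum_add_single] at hμ
        omega
      · exact h

theorem hasDerivAt_taylorPoly_line (a : (Fin d → ℕ) → ℂ) (p : ℕ) (h : Fin d → ℂ) (t : ℂ) :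
    HasDerivAt (fun s : ℂ => taylorPoly a (p + 1) (s • h))
      (∑ j, h j * taylorPoly (fun μ => a (μ + Pi.single j 1)) p (t • h)) t := by
  simp only [taylorPoly, monomialDivFactorial_smul]
  have h1 : HasDerivAt (fun s : ℂ => ∑ μ ∈ multiIndexLT d (p + 1),
      a μ * (s ^ (∑ j, μ j) * monomialDivFactorial μ h))
      (∑ μ ∈ multiIndexLT d (p + 1), a μ * (((∑ j, μ j : ℕ) : ℂ) * t ^ ((∑ j, μ j) - 1) *
        monomialDivFactorial μ h)) t :=
    HasDerivAt.fun_sum fun μ _ => ((hasDerivAt_pow _ t).mul_const _).const_mul _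
  convert h1 using 1
  have h2 : ∀ μ : Fin d → ℕ, a μ * (((∑ j, μ j : ℕ) : ℂ) * t ^ ((∑ j, μ j) - 1) *
      monomialDivFactorial μ h) =
      ∑ j, (μ j : ℂ) * (a μ * t ^ ((∑ j, μ j) - 1) * monomialDivFactorial μ h) := by
    intro μ
    rw [← Finset.sum_mul]
    push_cast
    ring
  simp only [h2]
  rw [Finset.sum_comm]
  refine Finset.sum_congr rfl fun j _ => ?_
  rw [sum_multiIndexLT_succ (fun μ => a μ * t ^ ((∑ j, μ j) - 1) * monomialDivFactorial μ h),
    Finset.mul_sum]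
  refine Finset.sum_congr rfl fun μ _ => ?_
  rw [sum_add_single, Nat.add_sub_cancel]
  linear_combination (-(a (μ + Pi.single j 1) * t ^ (∑ j, μ j))) *
    monomialDivFactorial_add_single μ j h

theorem taylorPoly_zero_right (a : (Fin d → ℕ) → ℂ) (p : ℕ) : taylorPoly a (p + 1) 0 = a 0 := by
  rw [taylorPoly, Finset.sum_eq_single_of_mem 0 (mem_multiIndexLT.2 (by simp))]
  · simp [monomialDivFactorial]
  · intro μ _ hμ
    obtain ⟨j, hj⟩ := Function.ne_iff.1 hμ
    rw [monomialDivFactorial, Finset.prod_eq_zero (Finset.mem_univ j), mul_zero]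
    simp [show μ j ≠ 0 from hj]

/-- Taylor's theorem for a compatible family of partial derivatives. -/
theorem norm_sub_taylorPoly_le {G : (Fin d → ℕ) → (Fin d → ℂ) → ℂ} {z : Fin d → ℂ} {ρ M : ℝ}
    (hM0 : 0 ≤ M)
    (hG : ∀ ν, DifferentiableOn ℂ (G ν) (ball z ρ))
    (hpart : ∀ ν j, ∀ w ∈ ball z ρ, cPartial d j (G ν) w = G (ν + Pi.single j 1) w)
    (p : ℕ) (ν : Fin d → ℕ) {h : Fin d → ℂ} (hh : ‖h‖ < ρ)
    (hM : ∀ κ : Fin d → ℕ, ∑ i, κ i = ∑ i, ν i + p → ∀ w ∈ ball z ρ, ‖G κ w‖ ≤ M) :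
    ‖G ν (z + h) - taylorPoly (fun μ => G (ν + μ) z) p h‖ ≤ M * (d * ‖h‖) ^ p := by
  induction p generalizing ν h with
  | zero =>
    simpa [taylorPoly, multiIndexLT] using hM ν rfl (z + h) (by simpa using hh)
  | succ p ih =>
    have hball : ∀ t ∈ Icc (0 : ℝ) 1, ‖(t : ℂ) • h‖ ≤ ‖h‖ := fun t ht => by
      rw [norm_smul, Complex.norm_real, Real.norm_of_nonneg ht.1]
      exact mul_le_of_le_one_left (norm_nonneg h) ht.2
    have hmem : ∀ t ∈ Icc (0 : ℝ) 1, z + (t : ℂ) • h ∈ ball z ρ := fun t ht => by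
      simpa using (hball t ht).trans_lt hh
    have hderiv : ∀ t ∈ Icc (0 : ℝ) 1, HasDerivAt
        (fun s : ℝ => G ν (z + (s : ℂ) • h) -
          taylorPoly (fun μ => G (ν + μ) z) (p + 1) ((s : ℂ) • h))
        (∑ j, h j * (G (ν + Pi.single j 1) (z + (t : ℂ) • h) -
          taylorPoly (fun μ => G (ν + Pi.single j 1 + μ) z) p ((t : ℂ) • h))) t := by
      intro t ht
      have h1 := hasDerivAt_comp_line (u := h)
        ((hG ν).differentiableAt (isOpen_ball.mem_nhds (hmem t ht)))
      have h2 := hasDerivAt_taylorPoly_line (fun μ => G (ν + μ) z) p h t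
      convert (h1.fun_sub h2).comp_ofReal using 1
      rw [fderiv_apply_eq_sum_cPartial, ← Finset.sum_sub_distrib]
      refine Finset.sum_congr rfl fun j _ => ?_
      rw [hpart ν j _ (hmem t ht), mul_sub]
      simp only [add_assoc, add_comm (Pi.single j 1)]
    have hbound := norm_image_sub_le_of_norm_deriv_le_segment_01'
      (C := M * (d * ‖h‖) ^ (p + 1)) (fun t ht => (hderiv t ht).hasDerivWithinAt) ?_
    · simpa [taylorPoly_zero_right] using hbound
    · intro t ht
      have ht' := Ico_subset_Icc_self ht
      calc _ ≤ ∑ _j : Fin d, ‖h‖ * (M * (d * ‖h‖) ^ p) := by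
            refine norm_sum_le_of_le _ fun j _ => ?_
            rw [norm_mul]
            gcongr
            · exact norm_le_pi_norm h j
            · refine (ih (ν + Pi.single j 1) ((hball t ht').trans_lt hh) fun κ hκ => hM κ ?_).trans ?_
              · rw [hκ, sum_add_single]
                ring
              · gcongr
                exact hball t ht'
        _ = M * (d * ‖h‖) ^ (p + 1) := by
            rw [Finset.sum_const, Finset.card_univ, Fintype.card_fin, nsmul_eq_mul]
            ring

theorem pow_div_pow_add_le {R x : ℝ} (hR : 0 < R) (hx : R ≤ 2 * x) {n q i : ℕ} (hi : q + i ≤ n) :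
    x ^ i / R ^ (q + i) ≤ 2 ^ n * x ^ (n - q) / R ^ n := by
  have hx0 : 0 < x := by linarith
  obtain ⟨k, rfl⟩ := Nat.exists_eq_add_of_le hi
  have hk : R ^ k ≤ 2 ^ (q + i + k) * x ^ k := by
    calc R ^ k ≤ (2 * x) ^ k := by gcongr
      _ = 2 ^ k * x ^ k := mul_pow _ _ _
      _ ≤ _ := by
        gcongr
        · norm_num
        · omega
  rw [show q + i + k - q = i + k by omega, div_le_div_iff₀ (by positivity) (by positivity)]
  calc x ^ i * R ^ (q + i + k) = (x ^ i * R ^ (q + i)) * R ^ k := by ring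
    _ ≤ (x ^ i * R ^ (q + i)) * (2 ^ (q + i + k) * x ^ k) := by gcongr
    _ = _ := by ring

/-- The constant in the Taylor remainder estimate `norm_remainder_le`. -/
noncomputable def remainderConst (d n : ℕ) : ℝ :=
  (2 * (n + 1 : ℕ)) ^ (n + 1) * (d + 1) ^ (n + 1) +
    (2 * (n + 1 : ℕ)) ^ (n + 1) * ((1 + (multiIndexLT d (n + 1)).card) * 2 ^ n)

theorem remainderConst_pos (d n : ℕ) : 0 < remainderConst d n := by
  unfold remainderConst
  positivity

/-- A Taylor remainder estimate which is uniform in the size of `h` relative to the radius `R`. -/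
theorem norm_remainder_le {g : (Fin d → ℂ) → ℂ} {z h : Fin d → ℂ} {R M : ℝ} (hR : 0 < R)
    (hg : DifferentiableOn ℂ g (ball z R)) (hM : ∀ w ∈ ball z R, ‖g w‖ ≤ M)
    (hg' : DifferentiableOn ℂ g (ball (z + h) R)) (hM' : ∀ w ∈ ball (z + h) R, ‖g w‖ ≤ M)
    {n : ℕ} {ν : Fin d → ℕ} (hν : ∑ i, ν i ≤ n) :
    ‖cMultiPartial d ν g (z + h) -
        taylorPoly (fun μ => cMultiPartial d (ν + μ) g z) (n - ∑ i, ν i + 1) h‖ ≤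
      remainderConst d n * (M / R ^ n * min 1 (2 * ‖h‖ / R)) * ‖h‖ ^ (n - ∑ i, ν i) := by
  have hM0 : 0 ≤ M := (norm_nonneg _).trans (hM z (mem_ball_self hR))
  have hR2 : 0 < R / 2 := by positivity
  set q := ∑ i, ν i with hq
  set p := n - q with hp
  set K : ℝ := (2 * (n + 1 : ℕ)) ^ (n + 1)
  have hK0 : 0 ≤ K := by positivity
  set c : ℝ := ((multiIndexLT d (n + 1)).card : ℝ) with hc
  rcases lt_or_ge ‖h‖ (R / 2) with hlt | hge
  · have hmin : min 1 (2 * ‖h‖ / R) = 2 * ‖h‖ / R :=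
      min_eq_right ((div_le_one hR).2 (by linarith))
    have hsub : ball z (R / 2) ⊆ ball z R := ball_subset_ball (by linarith)
    have key := norm_sub_taylorPoly_le (G := fun κ => cMultiPartial d κ g) (z := z) (ρ := R / 2)
      (M := K * M / R ^ (n + 1)) (by positivity)
      (fun κ => (differentiableOn_cMultiPartial isOpen_ball hg κ).mono hsub)
      (fun κ j w hw => cPartial_cMultiPartial isOpen_ball hg κ j (hsub hw)) (p + 1) ν hlt
      (fun κ hκ w hw => by
        have hκ' : ∑ i, κ i = n + 1 := by omega
        have := norm_cMultiPartial_le hR hg hM n.succ_pos hκ'.le hw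
        rwa [hκ'] at this)
    refine key.trans ?_
    have hd : (d : ℝ) ^ (p + 1) ≤ 2 * (d + 1) ^ (n + 1) := by
      calc (d : ℝ) ^ (p + 1) ≤ (d + 1) ^ (p + 1) := by gcongr; linarith
        _ ≤ (d + 1) ^ (n + 1) := by
          gcongr
          · linarith [Nat.cast_nonneg (α := ℝ) d]
          · omega
        _ ≤ _ := by
          have : (0 : ℝ) ≤ (d + 1) ^ (n + 1) := by positivity
          linarith
    rw [hmin]
    calc K * M / R ^ (n + 1) * (d * ‖h‖) ^ (p + 1)
        = K * (d : ℝ) ^ (p + 1) * (M / R ^ n * (‖h‖ / R)) * ‖h‖ ^ p := by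
          field_simp
          ring
      _ ≤ K * (2 * (d + 1) ^ (n + 1)) * (M / R ^ n * (‖h‖ / R)) * ‖h‖ ^ p := by gcongr
      _ = K * (d + 1) ^ (n + 1) * (M / R ^ n * (2 * ‖h‖ / R)) * ‖h‖ ^ p := by ring
      _ ≤ _ := by
        gcongr
        exact le_add_of_nonneg_right (by positivity)
  · have hmin : min 1 (2 * ‖h‖ / R) = 1 := min_eq_left ((one_le_div hR).2 (by linarith))
    have h2 : R ≤ 2 * ‖h‖ := by linarith
    rw [hmin, mul_one]
    have hterm : ∀ κ : Fin d → ℕ, ∀ i, ∑ j, κ j = q + i → q + i ≤ n → ∀ w,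
        DifferentiableOn ℂ g (ball w R) → (∀ y ∈ ball w R, ‖g y‖ ≤ M) →
        ‖cMultiPartial d κ g w‖ * ‖h‖ ^ i ≤ K * (2 ^ n * (M / R ^ n) * ‖h‖ ^ p) := by
      intro κ i hκ hi w hgw hMw
      have h1 := norm_cMultiPartial_le hR hgw hMw n.succ_pos (ν := κ) (by omega)
        (mem_ball_self hR2)
      rw [hκ] at h1
      calc _ ≤ K * M / R ^ (q + i) * ‖h‖ ^ i := by gcongr
        _ = K * M * (‖h‖ ^ i / R ^ (q + i)) := by ring
        _ ≤ K * M * (2 ^ n * ‖h‖ ^ p / R ^ n) :=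
          mul_le_mul_of_nonneg_left (pow_div_pow_add_le hR h2 hi) (mul_nonneg hK0 hM0)
        _ = _ := by ring
    have hfirst : ‖cMultiPartial d ν g (z + h)‖ ≤ K * (2 ^ n * (M / R ^ n) * ‖h‖ ^ p) := by
      simpa using hterm ν 0 rfl hν (z + h) hg' hM'
    have hpoly : ‖taylorPoly (fun μ => cMultiPartial d (ν + μ) g z) (p + 1) h‖ ≤
        c * (K * (2 ^ n * (M / R ^ n) * ‖h‖ ^ p)) := by
      calc _ ≤ ∑ _μ ∈ multiIndexLT d (p + 1), K * (2 ^ n * (M / R ^ n) * ‖h‖ ^ p) := by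
            refine norm_sum_le_of_le _ fun μ hμ => ?_
            rw [mem_multiIndexLT] at hμ
            rw [norm_mul]
            refine (mul_le_mul_of_nonneg_left (norm_monomialDivFactorial_le μ h)
              (norm_nonneg _)).trans ?_
            exact hterm (ν + μ) _ (by simp [Finset.sum_add_distrib, hq]) (by omega) z hg hM
        _ ≤ _ := by
          rw [Finset.sum_const, nsmul_eq_mul]
          gcongr
          rw [hc]
          norm_cast
          refine Finset.card_le_card fun μ hμ => ?_
          rw [mem_multiIndexLT] at hμ ⊢
          omega
    refine (norm_sub_le _ _).trans ((add_le_add hfirst hpoly).trans ?_)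
    calc _ = K * ((1 + c) * 2 ^ n) * (M / R ^ n) * ‖h‖ ^ p := by ring
      _ ≤ _ := by
        gcongr
        exact le_add_of_nonneg_left (by positivity)

/-- The tails `∑ b_m min(1, δ / r_m)` vanish as `δ → 0`. -/
theorem exists_pos_tsum_mul_min_le {b r : ℕ → ℝ} (hb : Summable b) (hb0 : ∀ m, 0 ≤ b m)
    (hr : ∀ m, 0 < r m) {ε : ℝ} (hε : 0 < ε) :
    ∃ δ > 0, Summable (fun m => b m * min 1 (δ / r m)) ∧ ∑' m, b m * min 1 (δ / r m) ≤ ε := by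
  have hle : ∀ δ > 0, ∀ m, ‖b m * min 1 (δ / r m)‖ ≤ b m := fun δ hδ m => by
    have : 0 ≤ δ / r m := (div_pos hδ (hr m)).le
    rw [Real.norm_of_nonneg (mul_nonneg (hb0 m) (le_min zero_le_one this))]
    exact mul_le_of_le_one_right (hb0 m) (min_le_left _ _)
  have hlim : Tendsto (fun δ : ℝ => ∑' m, b m * min 1 (δ / r m)) (𝓝[>] 0) (𝓝 (∑' _m : ℕ, 0)) := by
    refine tendsto_tsum_of_dominated_convergence hb (fun m => ?_) ?_
    · have : Continuous fun δ : ℝ => b m * min 1 (δ / r m) := by fun_prop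
      simpa using (this.tendsto 0).mono_left nhdsWithin_le_nhds
    · filter_upwards [self_mem_nhdsWithin] with δ hδ using hle δ hδ
  rw [tsum_zero] at hlim
  obtain ⟨δ, h1, h2⟩ := ((hlim.eventually_lt_const hε).and self_mem_nhdsWithin).exists
  exact ⟨δ, h2, .of_norm_bounded hb (hle δ h2), h1.le⟩

theorem norm_ofReal_comp (y : Fin d → ℝ) : ‖fun j => (y j : ℂ)‖ = ‖y‖ := by
  simp [Pi.norm_def]

theorem re_mul_monomialDivFactorial (a : ℂ) (μ : Fin d → ℕ) (x : Fin d → ℝ) :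
    (a * monomialDivFactorial μ fun j => (x j : ℂ)).re =
      a.re * (∏ j, x j ^ μ j) / ∏ j, (Nat.factorial (μ j) : ℝ) := by
  have : (monomialDivFactorial μ fun j => (x j : ℂ)) =
      (((∏ j, x j ^ μ j) / ∏ j, (Nat.factorial (μ j) : ℝ) : ℝ) : ℂ) := by
    simp [monomialDivFactorial, Finset.prod_div_distrib]
  rw [this, Complex.re_mul_ofReal, mul_div_assoc]

theorem re_taylorPoly (a : (Fin d → ℕ) → ℂ) (p : ℕ) (x : Fin d → ℝ) :
    (taylorPoly a p fun j => (x j : ℂ)).re =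
      ∑ μ ∈ multiIndexLT d p,
        ((a μ).re * ∏ j, x j ^ μ j) / ∏ j, (Nat.factorial (μ j) : ℝ) := by
  rw [taylorPoly, Complex.re_sum]
  exact Finset.sum_congr rfl fun μ _ => re_mul_monomialDivFactorial _ _ _

/-- Lemma B.7.2: if each `F m` is holomorphic and bounded by `B m` on the complex
`r m`-neighbourhood of `A` (with `r m ↓ 0`), is real on `A`, and
`Σ_m B m / (r m)^n < ∞`, then `f := Σ_m F m` is `C^n` on `A` in the Whitney sense, with
Whitney derivatives `f_ν = Σ_m ∂^ν F m`. -/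
theorem whitney_smoothness_of_analytic_series
    (d n : ℕ) (A : Set (Fin d → ℝ)) (hA : A.Nonempty)
    (F : ℕ → (Fin d → ℂ) → ℂ) (r : ℕ → ℝ) (B : ℕ → ℝ)
    (hrpos : ∀ m, 0 < r m) (hrmono : Antitone r)
    (hrlim : Filter.Tendsto r Filter.atTop (nhds 0))
    (hol : ∀ m, DifferentiableOn ℂ (F m)
      (⋃ y ∈ A, Metric.ball (fun j => (y j : ℂ)) (r m)))
    (hreal : ∀ m, ∀ y ∈ A, (F m (fun j => (y j : ℂ))).im = 0)
    (hB : ∀ m, ∀ z ∈ ⋃ y ∈ A, Metric.ball (fun j => (y j : ℂ)) (r m), ‖F m z‖ ≤ B m)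
    (hsum : Summable fun m => B m / (r m) ^ n) :
    IsWhitneyCn d n A
      (fun ν y => ∑' m, (cMultiPartial d ν (F m) (fun j => (y j : ℂ))).re) := by
  have hball : ∀ m, ∀ y ∈ A, ball (fun j => (y j : ℂ)) (r m) ⊆
      ⋃ y ∈ A, ball (fun j => (y j : ℂ)) (r m) := fun m y hy => subset_biUnion_of_mem
    (u := fun y : Fin d → ℝ => ball (fun j => (y j : ℂ)) (r m)) hy
  have hol' : ∀ m, ∀ y ∈ A, DifferentiableOn ℂ (F m) (ball (fun j => (y j : ℂ)) (r m)) :=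
    fun m y hy => (hol m).mono (hball m y hy)
  have hB' : ∀ m, ∀ y ∈ A, ∀ z ∈ ball (fun j => (y j : ℂ)) (r m), ‖F m z‖ ≤ B m :=
    fun m y hy z hz => hB m z (hball m y hy hz)
  have hB0 : ∀ m, 0 ≤ B m := fun m => by
    obtain ⟨y, hy⟩ := hA
    exact (norm_nonneg _).trans (hB' m y hy _ (mem_ball_self (hrpos m)))
  have hb0 : ∀ m, 0 ≤ B m / r m ^ n := fun m => div_nonneg (hB0 m) (pow_pos (hrpos m) n).le
  have hsummable : ∀ κ : Fin d → ℕ, ∑ j, κ j ≤ n → ∀ y ∈ A,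
      Summable fun m => (cMultiPartial d κ (F m) (fun j => (y j : ℂ))).re := by
    intro κ hκ y hy
    set K : ℝ := (2 * (n + 1 : ℕ)) ^ (n + 1)
    refine .of_norm_bounded (hsum.mul_left (K * r 0 ^ (n - ∑ j, κ j))) fun m => ?_
    refine (Complex.abs_re_le_norm _).trans ((norm_cMultiPartial_le (hrpos m) (hol' m y hy)
      (hB' m y hy) n.succ_pos (hκ.trans n.le_succ) (mem_ball_self (half_pos (hrpos m)))).trans ?_)
    have hr := hrpos m
    have hBm := hB0 m
    calc K * B m / r m ^ (∑ j, κ j)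
        = K * r m ^ (n - ∑ j, κ j) * (B m / r m ^ n) := by
          have hsplit : r m ^ n = r m ^ (n - ∑ j, κ j) * r m ^ (∑ j, κ j) := by
            rw [← pow_add, Nat.sub_add_cancel hκ]
          rw [hsplit]
          field_simp
      _ ≤ _ := by
          gcongr
          exact hrmono m.zero_le
  intro ε hε y₀ _
  have hC := remainderConst_pos d n
  obtain ⟨δ, hδ, hδsum, hδle⟩ := exists_pos_tsum_mul_min_le hsum hb0 hrpos (div_pos hε hC)
  refine ⟨δ / 4, by positivity, fun y hy y' hy' ν hν => ?_⟩
  set p := n - ∑ j, ν j with hp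
  let z : Fin d → ℂ := fun j => (y j : ℂ)
  let h : Fin d → ℂ := fun j => ((y' j - y j : ℝ) : ℂ)
  have hzh : z + h = fun j => (y' j : ℂ) := by
    ext j
    simp [z, h]
  have hnorm : ‖h‖ = ‖y' - y‖ := norm_ofReal_comp (y' - y)
  have hsmall : 2 * ‖h‖ ≤ δ := by
    have h1 := hy.2
    have h2 := hy'.2
    rw [mem_ball] at h1 h2
    rw [hnorm, ← dist_eq_norm]
    linarith [dist_triangle_right y' y y₀]
  have hset : (Finset.Iic (fun _ => n : Fin d → ℕ)).filter (fun μ => ∑ j, μ j ≤ p) =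
      multiIndexLT d (p + 1) := by
    ext μ
    rw [mem_multiIndexLT, Finset.mem_filter, Nat.lt_succ_iff, Finset.mem_Iic]
    refine and_iff_right_of_imp fun hμ i => ?_
    exact (Finset.single_le_sum (fun _ _ => Nat.zero_le _) (Finset.mem_univ i)).trans
      (hμ.trans (Nat.sub_le _ _))
  have hseries : HasSum
      (fun m => (cMultiPartial d ν (F m) (z + h) -
        taylorPoly (fun μ => cMultiPartial d (ν + μ) (F m) z) (p + 1) h).re)
      ((∑' m, (cMultiPartial d ν (F m) (fun j => (y' j : ℂ))).re) -
        ∑ μ ∈ multiIndexLT d (p + 1),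
          ((∑' m, (cMultiPartial d (ν + μ) (F m) z).re) * ∏ j, (y' j - y j) ^ (μ j)) /
            ∏ j, (Nat.factorial (μ j) : ℝ)) := by
    have hre : ∀ m, (cMultiPartial d ν (F m) (z + h) -
        taylorPoly (fun μ => cMultiPartial d (ν + μ) (F m) z) (p + 1) h).re =
        (cMultiPartial d ν (F m) (fun j => (y' j : ℂ))).re - ∑ μ ∈ multiIndexLT d (p + 1),
          ((cMultiPartial d (ν + μ) (F m) z).re * ∏ j, (y' j - y j) ^ (μ j)) /
            ∏ j, (Nat.factorial (μ j) : ℝ) := fun m => by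
      rw [Complex.sub_re, hzh, re_taylorPoly _ _ fun j => y' j - y j]
    rw [funext hre]
    have hterm : ∀ μ ∈ multiIndexLT d (p + 1), HasSum
        (fun m => ((cMultiPartial d (ν + μ) (F m) z).re * ∏ j, (y' j - y j) ^ (μ j)) /
          ∏ j, (Nat.factorial (μ j) : ℝ))
        (((∑' m, (cMultiPartial d (ν + μ) (F m) z).re) * ∏ j, (y' j - y j) ^ (μ j)) /
          ∏ j, (Nat.factorial (μ j) : ℝ)) := by
      intro μ hμ
      have hνμ : ∑ j, (ν + μ) j ≤ n := by
        rw [mem_multiIndexLT] at hμ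
        simp only [Pi.add_apply, Finset.sum_add_distrib]
        omega
      exact ((hsummable (ν + μ) hνμ y hy.1).hasSum.mul_right _).div_const _
    exact (hsummable ν hν y' hy'.1).hasSum.sub (hasSum_sum hterm)
  rw [hset, ← hseries.tsum_eq, ← Real.norm_eq_abs, ← hnorm]
  have hbound : HasSum
      (fun m => remainderConst d n * (B m / r m ^ n * min 1 (δ / r m)) * ‖h‖ ^ p)
      (remainderConst d n * (∑' m, B m / r m ^ n * min 1 (δ / r m)) * ‖h‖ ^ p) :=
    (hδsum.hasSum.mul_left _).mul_right _
  refine (tsum_of_norm_bounded hbound fun m => ?_).trans ?_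
  · refine (Complex.abs_re_le_norm _).trans ((norm_remainder_le (hrpos m) (hol' m y hy.1)
      (hB' m y hy.1) (hzh ▸ hol' m y' hy'.1) (hzh ▸ hB' m y' hy'.1) hν).trans ?_)
    have hr := hrpos m
    have hbm := hb0 m
    gcongr
  · gcongr
    rw [mul_comm]
    exact (le_div_iff₀ hC).1 hδle
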